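/- A finite bounded graded poset P contains a bowtie if and only if P contains a spindle of girth 4. Consequently, P is a lattice if and only if P contains no spindle of girth 4. -/

import Mathlib

/-- `m` is a minimal upper bound of `b` and `d`. -/
def IsMinimalUpperBoundOf {P : Type*} [PartialOrder P] (m b d : P) : Prop :=
  b ≤ m ∧ d ≤ m ∧ ∀ z, b ≤ z → d ≤ z → z ≤ m → z = m

/-- `m` is a maximal lower bound of `a` and `c`. -/
def IsMaximalLowerBoundOf {P : Type*} [PartialOrder P] (m a c : P) : Prop :=
  m ≤ a ∧ m ≤ c ∧ ∀ z, z ≤ a → z ≤ c → m ≤ z → z = m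

/-- A poset contains a bowtie if there are four distinct elements `a`, `b`, `c`, `d`
such that `a` and `c` are both minimal upper bounds of `b` and `d`, and `b` and `d`
are both maximal lower bounds of `a` and `c`. -/
def HasBowtie (P : Type*) [PartialOrder P] : Prop :=
  ∃ a b c d : P, a ≠ b ∧ a ≠ c ∧ a ≠ d ∧ b ≠ c ∧ b ≠ d ∧ c ≠ d ∧
    IsMinimalUpperBoundOf a b d ∧ IsMinimalUpperBoundOf c b d ∧
    IsMaximalLowerBoundOf b a c ∧ IsMaximalLowerBoundOf d a c

/-- `x` and `y` are complements in the interval `[z, w]`: both lie in the interval,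
`w` is their only common upper bound in the interval and `z` is their only common
lower bound in the interval. -/
def ComplementsIn {P : Type*} [PartialOrder P] (z w x y : P) : Prop :=
  z ≤ x ∧ x ≤ w ∧ z ≤ y ∧ y ≤ w ∧
  (∀ u, z ≤ u → u ≤ w → x ≤ u → y ≤ u → u = w) ∧
  (∀ u, z ≤ u → u ≤ w → u ≤ x → u ≤ y → u = z)

/-- A spindle of girth `2k` in the interval `[z, w]`: a `2k`-periodic sequence
`x : ℤ → P` of elements of the interval, distinct over one period and distinct from the
endpoints `z` and `w`, such that for every index of one parity `x (i-1)` and `x (i+1)`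
are complements in `[z, x i]`, and for every index of the other parity they are
complements in `[x i, w]`.  A global spindle is the case `z = ⊥`, `w = ⊤`. -/
def IsSpindleIn {P : Type*} [PartialOrder P] (z w : P) (k : ℕ) (x : ℤ → P) : Prop :=
  2 ≤ k ∧
  (∀ i : ℤ, x (i + 2 * k) = x i) ∧
  (∀ i j : ℤ, 0 ≤ i → i < 2 * k → 0 ≤ j → j < 2 * k → x i = x j → i = j) ∧
  (∀ i : ℤ, z ≤ x i ∧ x i ≤ w ∧ x i ≠ z ∧ x i ≠ w) ∧
  (((∀ i : ℤ, Even i → ComplementsIn z (x i) (x (i - 1)) (x (i + 1))) ∧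
    (∀ i : ℤ, Odd i → ComplementsIn (x i) w (x (i - 1)) (x (i + 1)))) ∨
   ((∀ i : ℤ, Odd i → ComplementsIn z (x i) (x (i - 1)) (x (i + 1))) ∧
    (∀ i : ℤ, Even i → ComplementsIn (x i) w (x (i - 1)) (x (i + 1)))))

section Bowtie

variable {P : Type*} [PartialOrder P]

theorem exists_isMinimalUpperBoundOf_le [Finite P] {x y m : P} (hx : x ≤ m) (hy : y ≤ m) :
    ∃ a, a ≤ m ∧ IsMinimalUpperBoundOf a x y := by
  obtain ⟨a, ham, ha⟩ :=
    (Set.toFinite {u : P | x ≤ u ∧ y ≤ u}).exists_le_minimal (a := m) ⟨hx, hy⟩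
  exact ⟨a, ham, ha.prop.1, ha.prop.2, fun z hxz hyz hza => ha.eq_of_le ⟨hxz, hyz⟩ hza⟩

theorem exists_le_isMaximalLowerBoundOf [Finite P] {x y m : P} (hx : m ≤ x) (hy : m ≤ y) :
    ∃ a, m ≤ a ∧ IsMaximalLowerBoundOf a x y := by
  obtain ⟨a, hma, ha⟩ :=
    (Set.toFinite {u : P | u ≤ x ∧ u ≤ y}).exists_le_maximal (a := m) ⟨hx, hy⟩
  exact ⟨a, hma, ha.prop.1, ha.prop.2, fun z hzx hzy haz => ha.eq_of_ge ⟨hzx, hzy⟩ haz⟩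

/-- The distinctness of a top from a bottom in a bowtie is automatic. -/
theorem hasBowtie_of_bounds {a b c d : P} (hac : a ≠ c) (hbd : b ≠ d)
    (ha : IsMinimalUpperBoundOf a b d) (hc : IsMinimalUpperBoundOf c b d)
    (hb : IsMaximalLowerBoundOf b a c) (hd : IsMaximalLowerBoundOf d a c) : HasBowtie P := by
  refine ⟨a, b, c, d, ?_, hac, ?_, ?_, hbd, ?_, ha, hc, hb, hd⟩
  · rintro rfl
    exact hac (hc.2.2 a ha.1 ha.2.1 hb.2.1)
  · rintro rfl
    exact hac (hc.2.2 a ha.1 ha.2.1 hd.2.1)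
  · rintro rfl
    exact hac (ha.2.2 b hc.1 hc.2.1 hb.1).symm
  · rintro rfl
    exact hac (ha.2.2 c hc.1 hc.2.1 hd.1).symm

theorem hasBowtie_of_two_minimalUpperBounds [Finite P] {x y a c : P} (hac : a ≠ c)
    (ha : IsMinimalUpperBoundOf a x y) (hc : IsMinimalUpperBoundOf c x y) : HasBowtie P := by
  obtain ⟨b, hxb, hb⟩ := exists_le_isMaximalLowerBoundOf ha.1 hc.1
  obtain ⟨d, hyd, hd⟩ := exists_le_isMaximalLowerBoundOf ha.2.1 hc.2.1
  refine hasBowtie_of_bounds hac ?_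
    ⟨hb.1, hd.1, fun z hbz hdz => ha.2.2 z (hxb.trans hbz) (hyd.trans hdz)⟩
    ⟨hb.2.1, hd.2.1, fun z hbz hdz => hc.2.2 z (hxb.trans hbz) (hyd.trans hdz)⟩ hb hd
  rintro rfl
  exact hac ((ha.2.2 b hxb hyd hb.1).symm.trans (hc.2.2 b hxb hyd hb.2.1))

theorem hasBowtie_of_two_maximalLowerBounds [Finite P] {x y b d : P} (hbd : b ≠ d)
    (hb : IsMaximalLowerBoundOf b x y) (hd : IsMaximalLowerBoundOf d x y) : HasBowtie P := by
  obtain ⟨a, hax, ha⟩ := exists_isMinimalUpperBoundOf_le hb.1 hd.1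
  obtain ⟨c, hcy, hc⟩ := exists_isMinimalUpperBoundOf_le hb.2.1 hd.2.1
  refine hasBowtie_of_bounds ?_ hbd ha hc
    ⟨ha.1, hc.1, fun z hza hzc => hb.2.2 z (hza.trans hax) (hzc.trans hcy)⟩
    ⟨ha.2.1, hc.2.1, fun z hza hzc => hd.2.2 z (hza.trans hax) (hzc.trans hcy)⟩
  rintro rfl
  exact hbd ((hb.2.2 a hax hcy ha.1).symm.trans (hd.2.2 a hax hcy ha.2.1))

theorem ComplementsIn.isMinimalUpperBoundOf {z w x y : P} (h : ComplementsIn z w x y) :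
    IsMinimalUpperBoundOf w x y :=
  ⟨h.2.1, h.2.2.2.1, fun u hxu hyu huw => h.2.2.2.2.1 u (h.1.trans hxu) huw hxu hyu⟩

theorem ComplementsIn.isMaximalLowerBoundOf {z w x y : P} (h : ComplementsIn z w x y) :
    IsMaximalLowerBoundOf z x y :=
  ⟨h.1, h.2.2.1, fun u hux huy hzu => h.2.2.2.2.2 u hzu (hux.trans h.2.1) hux huy⟩

theorem complementsIn_of_bounds {z w x y : P} (hw : IsMinimalUpperBoundOf w x y)
    (hz : IsMaximalLowerBoundOf z x y) : ComplementsIn z w x y :=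
  ⟨hz.1, hw.1, hz.2.1, hw.2.1, fun u _ huw hxu hyu => hw.2.2 u hxu hyu huw,
    fun u hzu _ hux huy => hz.2.2 u hux huy hzu⟩

theorem ComplementsIn.symm {z w x y : P} (h : ComplementsIn z w x y) : ComplementsIn z w y x :=
  ⟨h.2.2.1, h.2.2.2.1, h.1, h.2.1, fun u hzu huw hyu hxu => h.2.2.2.2.1 u hzu huw hxu hyu,
    fun u hzu huw huy hux => h.2.2.2.2.2 u hzu huw hux huy⟩

theorem IsSpindleIn.hasBowtie {z w : P} {x : ℤ → P} (h : IsSpindleIn z w 2 x) :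
    HasBowtie P := by
  obtain ⟨-, hper, hinj, -, h⟩ := h
  have h02 : x 0 ≠ x 2 := fun e => by
    have := hinj 0 2 (by norm_num) (by norm_num) (by norm_num) (by norm_num) e
    omega
  have h13 : x 1 ≠ x 3 := fun e => by
    have := hinj 1 3 (by norm_num) (by norm_num) (by norm_num) (by norm_num) e
    omega
  have h4 : x 4 = x 0 := by simpa using hper 0
  have h5 : x 5 = x 1 := by simpa using hper 1
  rcases h with ⟨he, ho⟩ | ⟨ho, he⟩
  all_goals
    have c1 := ho 1 (by decide)
    have c2 := he 2 (by decide)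
    have c3 := ho 3 (by decide)
    have c4 := he 4 (by decide)
    norm_num [h4, h5] at c1 c2 c3 c4
  · exact hasBowtie_of_bounds h02 h13 c4.symm.isMinimalUpperBoundOf c2.isMinimalUpperBoundOf
      c1.isMaximalLowerBoundOf c3.symm.isMaximalLowerBoundOf
  · exact hasBowtie_of_bounds h13 h02 c1.isMinimalUpperBoundOf
      c3.symm.isMinimalUpperBoundOf c4.symm.isMaximalLowerBoundOf c2.isMaximalLowerBoundOf

/-- The `4`-periodic sequence with values `a`, `b`, `c`, `d`. -/
def fourCycle (a b c d : P) (i : ℤ) : P :=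
  if i % 4 = 0 then a else if i % 4 = 1 then b else if i % 4 = 2 then c else d

theorem HasBowtie.exists_isSpindleIn [BoundedOrder P] [Finite P] (h : HasBowtie P) :
    ∃ (z w : P) (x : ℤ → P), IsSpindleIn z w 2 x := by
  obtain ⟨a, b, c, d, hab, hac, had, hbc, hbd, hcd, ha, hc, hb, hd⟩ := h
  obtain ⟨z, -, hz⟩ := exists_le_isMaximalLowerBoundOf (bot_le (a := b)) (bot_le (a := d))
  obtain ⟨w, -, hw⟩ := exists_isMinimalUpperBoundOf_le (le_top (a := a)) (le_top (a := c))
  have hzb : b ≠ z := fun e => had (ha.2.2 d (e ▸ hz.2.1) le_rfl hd.1).symm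
  have hzd : d ≠ z := fun e => hab (ha.2.2 b le_rfl (e ▸ hz.1) hb.1).symm
  have hwa : a ≠ w := fun e => hbc (hb.2.2 c (e ▸ hw.2.1) le_rfl hc.1).symm
  have hwc : c ≠ w := fun e => hab (hb.2.2 a le_rfl (e ▸ hw.1) ha.1)
  have ca := complementsIn_of_bounds ha hz
  have cc := complementsIn_of_bounds hc hz
  have cb := complementsIn_of_bounds hw hb
  have cd := complementsIn_of_bounds hw hd
  refine ⟨z, w, fourCycle a b c d, le_rfl, fun i => ?_, fun i j hi hi' hj hj' e => ?_,
    fun i => ?_, Or.inl ⟨fun i hi => ?_, fun i hi => ?_⟩⟩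
  · simp [fourCycle]
  · norm_num at hi' hj'
    interval_cases i <;> interval_cases j <;> simp_all [fourCycle]
  · have hza : a ≠ z := fun e => hab (le_antisymm (e ▸ hz.1) hb.1)
    have hzc : c ≠ z := fun e => hbc (le_antisymm hb.2.1 (e ▸ hz.1))
    have hwb : b ≠ w := fun e => hab (le_antisymm (e ▸ hw.1) hb.1)
    have hwd : d ≠ w := fun e => had (le_antisymm (e ▸ hw.1) hd.1)
    unfold fourCycle
    split_ifs
    · exact ⟨hz.1.trans ha.1, hw.1, hza, hwa⟩
    · exact ⟨hz.1, hb.1.trans hw.1, hzb, hwb⟩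
    · exact ⟨hz.1.trans hc.1, hw.2.1, hzc, hwc⟩
    · exact ⟨hz.2.1, hd.1.trans hw.1, hzd, hwd⟩
  · have : i % 4 = 0 ∧ (i - 1) % 4 = 3 ∧ (i + 1) % 4 = 1 ∨
        i % 4 = 2 ∧ (i - 1) % 4 = 1 ∧ (i + 1) % 4 = 3 := by grind
    rcases this with ⟨h0, h1, h2⟩ | ⟨h0, h1, h2⟩
    · simpa [fourCycle, h0, h1, h2] using ca.symm
    · simpa [fourCycle, h0, h1, h2] using cc
  · have : i % 4 = 1 ∧ (i - 1) % 4 = 0 ∧ (i + 1) % 4 = 2 ∨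
        i % 4 = 3 ∧ (i - 1) % 4 = 2 ∧ (i + 1) % 4 = 0 := by grind
    rcases this with ⟨h0, h1, h2⟩ | ⟨h0, h1, h2⟩
    · simpa [fourCycle, h0, h1, h2] using cb
    · simpa [fourCycle, h0, h1, h2] using cd.symm

theorem existsUnique_bounds_iff_not_hasBowtie [BoundedOrder P] [Finite P] :
    (∀ x y : P, (∃! m, IsMinimalUpperBoundOf m x y) ∧ (∃! m, IsMaximalLowerBoundOf m x y)) ↔
      ¬ HasBowtie P := by
  constructor
  · rintro h ⟨a, b, c, d, -, hac, -, -, -, -, ha, hc, -, -⟩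
    exact hac ((h b d).1.unique ha hc)
  · intro h x y
    obtain ⟨m, -, hm⟩ := exists_isMinimalUpperBoundOf_le (le_top (a := x)) (le_top (a := y))
    obtain ⟨l, -, hl⟩ := exists_le_isMaximalLowerBoundOf (bot_le (a := x)) (bot_le (a := y))
    refine ⟨⟨m, hm, fun m' hm' => ?_⟩, ⟨l, hl, fun l' hl' => ?_⟩⟩
    · by_contra hne
      exact h (hasBowtie_of_two_minimalUpperBounds hne hm' hm)
    · by_contra hne
      exact h (hasBowtie_of_two_maximalLowerBounds hne hl' hl)

end Bowtie

/-- A finite bounded graded poset contains a bowtie iff it contains a (local) spindle of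
girth `4`; consequently it is a lattice iff it contains no spindle of girth `4`. -/
theorem bowtie_iff_spindle_girth_four {P : Type*} [PartialOrder P] [BoundedOrder P]
    [Fintype P] (n : ℕ) (ρ : P → ℕ) (hbot : ρ ⊥ = 0) (htop : ρ ⊤ = n)
    (hcov : ∀ a b : P, a ⋖ b → ρ b = ρ a + 1) :
    (HasBowtie P ↔ ∃ (z w : P) (x : ℤ → P), IsSpindleIn z w 2 x) ∧
    ((∀ x y : P, (∃! m, IsMinimalUpperBoundOf m x y) ∧
        (∃! m, IsMaximalLowerBoundOf m x y)) ↔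
      ¬ ∃ (z w : P) (x : ℤ → P), IsSpindleIn z w 2 x) := by
  have hiff : HasBowtie P ↔ ∃ (z w : P) (x : ℤ → P), IsSpindleIn z w 2 x :=
    ⟨HasBowtie.exists_isSpindleIn, fun ⟨_, _, _, h⟩ => h.hasBowtie⟩
  exact ⟨hiff, existsUnique_bounds_iff_not_hasBowtie.trans (not_congr hiff)⟩
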